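/- arXiv:math/0609402 — 3 statements merged into one kernel-verified Lean document; each statement's English description precedes it below -/
import Mathlib

section
/- Assume Φ satisfies the growth condition and M_Φ ≠ ∅. Then M̂_Φ = [M_Φ] ∩ M₁, i.e., the set of separating measures with finite loss-entropy equals the intersection of the linear span of the finite-entropy measures with the set of all separating measures. -/
open MeasureTheory Set ENNReal

noncomputable section

variable {Ω : Type*} [MeasurableSpace Ω]

/-- A wedge: nonempty, closed under addition and nonnegative scalar multiplication. -/
def IsWedgeF {V : Type*} [AddCommMonoid V] [SMul ℝ V] (C : Set V) : Prop :=
  C.Nonempty ∧ (∀ x ∈ C, ∀ y ∈ C, x + y ∈ C) ∧ ∀ c : ℝ, 0 ≤ c → ∀ x ∈ C, c • x ∈ C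

/-- The set `M₁(P;K)` of separating measures for the wedge `K ⊆ L⁰`. -/
def Msep (P : Measure Ω) (K : Set (Ω →ₘ[P] ℝ)) : Set (Measure Ω) :=
  {Q | IsProbabilityMeasure Q ∧ Q ≪ P ∧
    ∀ X ∈ K, Integrable (X : Ω → ℝ) Q ∧ ∫ ω, X ω ∂Q ≤ 0}

/-- Positive part of an extended-real value, as an extended nonnegative real. -/
def epos (x : EReal) : ℝ≥0∞ := if x = ⊤ then ⊤ else ENNReal.ofReal x.toReal

/-- Convexity of `Φ : [0,∞) → (−∞,∞]` on the nonnegative half-line. -/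
def ConvexOnNonneg (Φ : ℝ → EReal) : Prop :=
  ∀ x ∈ Ici (0:ℝ), ∀ y ∈ Ici (0:ℝ), ∀ t ∈ Icc (0:ℝ) 1,
    Φ (t * x + (1 - t) * y) ≤ (t : EReal) * Φ x + ((1 - t : ℝ) : EReal) * Φ y

/-- The growth condition on `Φ` (reasonable asymptotic elasticity). -/
def GrowthCond (Φ : ℝ → EReal) : Prop :=
  ∀ l0 l1 : ℝ, 0 < l0 → l0 ≤ l1 → ∃ a : ℝ, 0 < a ∧ ∃ b : ℝ, 0 < b ∧
    ∀ y : ℝ, 0 < y → ∀ l ∈ Icc l0 l1,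
      epos (Φ (l * y)) ≤ ENNReal.ofReal a * epos (Φ y) + ENNReal.ofReal (b * (y + 1))

/-- `Q` has finite entropy: `E_P[Φ⁺(dQ/dP)] < ∞`. -/
def FiniteEntropy (Φ : ℝ → EReal) (P Q : Measure Ω) : Prop :=
  ∫⁻ ω, epos (Φ ((Q.rnDeriv P ω).toReal)) ∂P < ⊤

/-- `Q` has finite loss-entropy: `E_P[Φ⁺(dQ/dP) 1_{dQ/dP ≥ 1}] < ∞`. -/
def FiniteLossEntropy (Φ : ℝ → EReal) (P Q : Measure Ω) : Prop :=
  ∫⁻ ω in {ω | 1 ≤ (Q.rnDeriv P ω).toReal},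
    epos (Φ ((Q.rnDeriv P ω).toReal)) ∂P < ⊤

/-- The set `M_Φ` of separating measures with finite entropy. -/
def MPhi (Φ : ℝ → EReal) (P : Measure Ω) (K : Set (Ω →ₘ[P] ℝ)) : Set (Measure Ω) :=
  {Q ∈ Msep P K | FiniteEntropy Φ P Q}

/-- The set `M̂_Φ` of separating measures with finite loss-entropy. -/
def MPhiHat (Φ : ℝ → EReal) (P : Measure Ω) (K : Set (Ω →ₘ[P] ℝ)) : Set (Measure Ω) :=
  {Q ∈ Msep P K | FiniteLossEntropy Φ P Q}

/-- Convexity for a set of measures. -/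
def ConvexM {Ω : Type*} [MeasurableSpace Ω] (M : Set (Measure Ω)) : Prop :=
  ∀ Q₀ ∈ M, ∀ Q₁ ∈ M, ∀ x : ℝ, 0 < x → x < 1 →
    ENNReal.ofReal x • Q₀ + ENNReal.ofReal (1 - x) • Q₁ ∈ M

/-- `M` is a face of the convex set `C` of measures. -/
def IsFaceOf {Ω : Type*} [MeasurableSpace Ω] (M C : Set (Measure Ω)) : Prop :=
  M ⊆ C ∧ ConvexM M ∧
    ∀ Q₀ ∈ C, ∀ Q₁ ∈ C, ∀ x : ℝ, 0 < x → x < 1 →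
      ENNReal.ofReal x • Q₀ + ENNReal.ofReal (1 - x) • Q₁ ∈ M → Q₀ ∈ M ∧ Q₁ ∈ M

/-- `Q` lies in the linear span of the set of measures `M` (inside the space of
signed measures): `Q` is a finite real linear combination of members of `M`. -/
def InSpanM {Ω : Type*} [MeasurableSpace Ω] (M : Set (Measure Ω)) (Q : Measure Ω) : Prop :=
  ∃ (n : ℕ) (c : Fin n → ℝ) (Qs : Fin n → Measure Ω), (∀ i, Qs i ∈ M) ∧
    ∀ s : Set Ω, MeasurableSet s → (Q s).toReal = ∑ i, c i * ((Qs i) s).toReal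

/-- Quasi-convexity of `Φ⁺`. -/
lemma epos_quasi {Φ : ℝ → EReal} (hconv : ConvexOnNonneg Φ)
    (hbot : ∀ x : ℝ, 0 ≤ x → Φ x ≠ ⊥) {x y z : ℝ} (hy : 0 ≤ y) (hyx : y ≤ x) (hxz : x ≤ z) :
    epos (Φ x) ≤ max (epos (Φ y)) (epos (Φ z)) := by
  by_cases h1 : Φ y = ⊤
  · simp [epos, h1]
  by_cases h2 : Φ z = ⊤
  · simp [epos, h2]
  have hz : 0 ≤ z := hy.trans (hyx.trans hxz)
  obtain ⟨t, ht, htx⟩ : ∃ t ∈ Icc (0:ℝ) 1, t * y + (1 - t) * z = x := by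
    have hmem : x ∈ segment ℝ y z := by
      rw [segment_eq_Icc (hyx.trans hxz)]; exact ⟨hyx, hxz⟩
    obtain ⟨a, b, ha, hb, hab, h⟩ := hmem
    refine ⟨a, ⟨ha, by linarith⟩, ?_⟩
    rw [← h, ← hab]; simp
  have h := hconv y hy z hz t ht
  rw [htx] at h
  have ey := EReal.coe_toReal h1 (hbot y hy)
  have ez := EReal.coe_toReal h2 (hbot z hz)
  have hx0 : 0 ≤ x := hy.trans hyx
  have hfx : Φ x ≠ ⊤ := by
    intro hx
    rw [hx, ← ey, ← ez, ← EReal.coe_mul, ← EReal.coe_mul, ← EReal.coe_add, top_le_iff] at h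
    exact EReal.coe_ne_top _ h
  have ex := EReal.coe_toReal hfx (hbot x hx0)
  rw [← ex, ← ey, ← ez, ← EReal.coe_mul, ← EReal.coe_mul, ← EReal.coe_add,
    EReal.coe_le_coe_iff] at h
  simp only [epos, h1, h2, hfx, if_false]
  rw [← ENNReal.ofReal_max]
  apply ENNReal.ofReal_le_ofReal
  have := le_max_left (Φ y).toReal (Φ z).toReal
  have := le_max_right (Φ y).toReal (Φ z).toReal
  have h3 := ht.1
  have h4 := ht.2
  nlinarith

lemma epos_avg {Φ : ℝ → EReal} (hconv : ConvexOnNonneg Φ)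
    (hbot : ∀ x : ℝ, 0 ≤ x → Φ x ≠ ⊥) {y z : ℝ} (hy : 0 ≤ y) (hz : 0 ≤ z) :
    epos (Φ ((y + z) / 2)) ≤ epos (Φ y) + epos (Φ z) := by
  rcases le_total y z with h | h
  · exact (epos_quasi hconv hbot hy (by linarith) (by linarith)).trans
      (max_le le_self_add le_add_self)
  · exact (epos_quasi hconv hbot hz (x := (y + z) / 2) (by linarith) (by linarith)).trans
      (max_le le_add_self le_self_add)

lemma measurable_epos {Φ : ℝ → EReal} (hconv : ConvexOnNonneg Φ)
    (hbot : ∀ x : ℝ, 0 ≤ x → Φ x ≠ ⊥) : Measurable (fun x : ℝ => epos (Φ (max x 0))) := by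
  apply measurable_of_Iic
  intro c
  apply OrdConnected.measurableSet
  constructor
  intro y hy z hz x hx
  simp only [mem_preimage, mem_Iic] at hy hz ⊢
  exact (epos_quasi hconv hbot (le_max_right y 0) (max_le_max_right 0 hx.1)
    (max_le_max_right 0 hx.2)).trans (max_le hy hz)

lemma measurable_epos_rnDeriv {Φ : ℝ → EReal} (hconv : ConvexOnNonneg Φ)
    (hbot : ∀ x : ℝ, 0 ≤ x → Φ x ≠ ⊥) (P Q : Measure Ω) :
    Measurable (fun ω => epos (Φ ((Q.rnDeriv P ω).toReal))) := by
  have := (measurable_epos hconv hbot).comp (Q.measurable_rnDeriv P).ennreal_toReal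
  simpa [Function.comp_def] using this

lemma epos_ne_top {Φ : ℝ → EReal} {x : ℝ} (h : Φ x ≠ ⊤) : epos (Φ x) ≠ ⊤ := by
  simp [epos, h]

lemma lin_finite (P Q : Measure Ω) [IsProbabilityMeasure P] [IsProbabilityMeasure Q] (b : ℝ) :
    ∫⁻ ω, ENNReal.ofReal (b * ((Q.rnDeriv P ω).toReal + 1)) ∂P < ⊤ := by
  have : Integrable (fun ω => b * ((Q.rnDeriv P ω).toReal + 1)) P :=
    (Measure.integrable_toReal_rnDeriv.add (integrable_const 1)).const_mul b
  exact this.lintegral_lt_top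

lemma growth_finite {Φ : ℝ → EReal} (hconv : ConvexOnNonneg Φ)
    (hbot : ∀ x : ℝ, 0 ≤ x → Φ x ≠ ⊥) (P Q : Measure Ω) [IsProbabilityMeasure P]
    [IsProbabilityMeasure Q] (h1 : Φ 1 ≠ ⊤) (hQ : FiniteEntropy Φ P Q) (a b : ℝ) :
    ∫⁻ ω, (epos (Φ 1) + (ENNReal.ofReal a * epos (Φ ((Q.rnDeriv P ω).toReal)) +
      ENNReal.ofReal (b * ((Q.rnDeriv P ω).toReal + 1)))) ∂P < ⊤ := by
  have hm := measurable_epos_rnDeriv hconv hbot P Q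
  rw [lintegral_add_left measurable_const, lintegral_add_left (hm.const_mul _),
    lintegral_const_mul _ hm]
  have := lin_finite P Q b
  simp only [lintegral_const, measure_univ, mul_one, ENNReal.add_lt_top]
  exact ⟨(epos_ne_top h1).lt_top, ENNReal.mul_lt_top ENNReal.ofReal_lt_top hQ, this⟩

lemma rnDeriv_mix (P Q Q0 : Measure Ω) [IsProbabilityMeasure P] [IsProbabilityMeasure Q]
    [IsProbabilityMeasure Q0] :
    ∀ᵐ ω ∂P, (((2⁻¹ : ℝ≥0∞) • (Q + Q0)).rnDeriv P ω).toReal =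
      ((Q.rnDeriv P ω).toReal + (Q0.rnDeriv P ω).toReal) / 2 := by
  filter_upwards [Measure.rnDeriv_smul_left_of_ne_top (Q + Q0) P (r := 2⁻¹) (by simp),
    Measure.rnDeriv_add' Q Q0 P, Q.rnDeriv_lt_top P, Q0.rnDeriv_lt_top P] with ω h1 h2 h3 h4
  rw [h1, Pi.smul_apply, h2, Pi.add_apply, smul_eq_mul, ENNReal.toReal_mul,
    ENNReal.toReal_add h3.ne h4.ne]
  simp
  ring

lemma Msep_mix (P : Measure Ω) [IsProbabilityMeasure P] (K : Set (Ω →ₘ[P] ℝ))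
    {Q Q0 : Measure Ω} (hQ : Q ∈ Msep P K) (hQ0 : Q0 ∈ Msep P K) :
    (2⁻¹ : ℝ≥0∞) • (Q + Q0) ∈ Msep P K := by
  obtain ⟨h1, h2, h3⟩ := hQ
  obtain ⟨k1, k2, k3⟩ := hQ0
  refine ⟨⟨?_⟩, ?_, ?_⟩
  · simp only [Measure.smul_apply, Measure.add_apply, measure_univ, smul_eq_mul]
    rw [one_add_one_eq_two]
    exact ENNReal.inv_mul_cancel (by simp) (by simp)
  · intro s hs
    simp [h2 hs, k2 hs]
  · intro X hX
    have i := (h3 X hX)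
    have j := (k3 X hX)
    refine ⟨(i.1.add_measure j.1).smul_measure (by simp), ?_⟩
    rw [integral_smul_measure, integral_add_measure i.1 j.1]
    simp only [ENNReal.toReal_inv, ENNReal.toReal_ofNat, smul_eq_mul]
    linarith [i.2, j.2]

lemma ae_le_of_span (P Q : Measure Ω) [IsProbabilityMeasure P] [IsProbabilityMeasure Q]
    (n : ℕ) (c : Fin n → ℝ) (Qs : Fin n → Measure Ω) (hQ : Q ≪ P)
    (hp : ∀ i, IsProbabilityMeasure (Qs i)) (ha : ∀ i, Qs i ≪ P)
    (h : ∀ s : Set Ω, MeasurableSet s → (Q s).toReal = ∑ i, c i * ((Qs i) s).toReal) :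
    ∀ᵐ ω ∂P, (Q.rnDeriv P ω).toReal ≤ ∑ i, |c i| * ((Qs i).rnDeriv P ω).toReal := by
  have key : Q.rnDeriv P ≤ᵐ[P] fun ω => ∑ i, ENNReal.ofReal |c i| * (Qs i).rnDeriv P ω := by
    apply ae_le_of_forall_setLIntegral_le_of_sigmaFinite (Q.measurable_rnDeriv P)
    intro s hs _
    rw [Measure.setLIntegral_rnDeriv hQ, lintegral_finsetSum _
      (fun i _ => ((Qs i).measurable_rnDeriv P).const_mul _)]
    have : ∀ i, ∫⁻ ω in s, ENNReal.ofReal |c i| * (Qs i).rnDeriv P ω ∂P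
        = ENNReal.ofReal (|c i| * (Qs i s).toReal) := by
      intro i
      rw [lintegral_const_mul _ ((Qs i).measurable_rnDeriv P),
        Measure.setLIntegral_rnDeriv (ha i), ENNReal.ofReal_mul (abs_nonneg _),
        ENNReal.ofReal_toReal (measure_ne_top _ _)]
    simp_rw [this]
    rw [← ENNReal.ofReal_sum_of_nonneg (fun i _ => by positivity),
      ← ENNReal.ofReal_toReal (measure_ne_top Q s), h s hs]
    apply ENNReal.ofReal_le_ofReal
    gcongr
    exact le_abs_self _
  have hfin : ∀ᵐ ω ∂P, ∀ i, (Qs i).rnDeriv P ω < ⊤ :=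
    ae_all_iff.2 fun i => (Qs i).rnDeriv_lt_top P
  filter_upwards [key, hfin] with ω h1 h2
  have hne : ∀ i ∈ Finset.univ, ENNReal.ofReal |c i| * (Qs i).rnDeriv P ω ≠ ⊤ :=
    fun i _ => ENNReal.mul_ne_top ENNReal.ofReal_ne_top (h2 i).ne
  have := ENNReal.toReal_mono (ENNReal.sum_ne_top.2 hne) h1
  rw [ENNReal.toReal_sum hne] at this
  simpa [ENNReal.toReal_mul] using this

/-- If `Φ` satisfies the growth condition and `M_Φ ≠ ∅`, then the set of
separating measures with finite loss-entropy equals the intersection of the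
linear span of the finite-entropy measures with the set of separating measures:
`M̂_Φ = [M_Φ] ∩ M₁`. -/
theorem MPhiHat_eq_span_MPhi_inter (P : Measure Ω) [IsProbabilityMeasure P]
    (K : Set (Ω →ₘ[P] ℝ)) (hK : IsWedgeF K)
    (Φ : ℝ → EReal) (hconv : ConvexOnNonneg Φ)
    (hfin : ∀ x : ℝ, 0 < x → Φ x ≠ ⊤) (hbot : ∀ x : ℝ, 0 ≤ x → Φ x ≠ ⊥)
    (hgrowth : GrowthCond Φ) (hMne : (MPhi Φ P K).Nonempty) :
    MPhiHat Φ P K = {Q ∈ Msep P K | InSpanM (MPhi Φ P K) Q} := by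
  ext Q
  constructor
  · rintro ⟨hQ, hQe⟩
    refine ⟨hQ, ?_⟩
    obtain ⟨Q0, hQ0, hQ0e⟩ := hMne
    have hp := hQ.1
    have hp0 := hQ0.1
    refine ⟨2, ![2, -1], ![(2⁻¹ : ℝ≥0∞) • (Q + Q0), Q0], ?_, ?_⟩
    · intro i
      fin_cases i
      · refine ⟨Msep_mix P K hQ hQ0, ?_⟩
        obtain ⟨a, _, b, _, hg⟩ := hgrowth (1/2) (1/2) (by norm_num) le_rfl
        have hmeas : MeasurableSet {ω | 1 ≤ (Q.rnDeriv P ω).toReal} :=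
          measurableSet_le measurable_const (Q.measurable_rnDeriv P).ennreal_toReal
        unfold FiniteLossEntropy at hQe
        rw [← lintegral_indicator hmeas] at hQe
        have hm0 := measurable_epos_rnDeriv hconv hbot P Q0
        have hm := (measurable_epos_rnDeriv hconv hbot P Q).indicator hmeas
        have hG := growth_finite hconv hbot P Q0 (hfin 1 one_pos) hQ0e a b
        have hT := ENNReal.add_lt_top.2 ⟨ENNReal.add_lt_top.2 ⟨hQe, hQ0e⟩, hG⟩
        rw [← lintegral_add_left hm, ← lintegral_add_left (by exact hm.add hm0)] at hT
        refine lt_of_le_of_lt (lintegral_mono_ae ?_) hT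
        filter_upwards [rnDeriv_mix P Q Q0] with ω hω
        simp only [Matrix.cons_val_zero, Fin.zero_eta] at hω ⊢
        rw [hω]
        have hf : 0 ≤ (Q.rnDeriv P ω).toReal := ENNReal.toReal_nonneg
        have hgn : 0 ≤ (Q0.rnDeriv P ω).toReal := ENNReal.toReal_nonneg
        by_cases h1 : 1 ≤ (Q.rnDeriv P ω).toReal
        · rw [indicator_of_mem (by exact h1)]
          exact (epos_avg hconv hbot hf hgn).trans le_self_add
        · rw [indicator_of_notMem (by exact h1), zero_add]
          push Not at h1
          generalize (Q.rnDeriv P ω).toReal = f at *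
          generalize (Q0.rnDeriv P ω).toReal = g at *
          rcases hgn.eq_or_lt with h0 | h0
          · subst h0
            refine (epos_quasi hconv hbot (x := (f + 0) / 2) le_rfl (by linarith)
              (show _ ≤ (1:ℝ) by linarith)).trans (max_le le_self_add ?_)
            exact le_self_add.trans le_add_self
          · refine (epos_quasi hconv hbot (x := (f + g) / 2) (y := 1 / 2 * g) (z := (g + 1) / 2)
              (by positivity) (by linarith) (by linarith)).trans (max_le ?_ ?_)
            · exact (hg g h0 (1/2) ⟨le_rfl, le_rfl⟩).trans (le_add_self.trans le_add_self)
            · refine (epos_avg hconv hbot hgn zero_le_one).trans ?_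
              gcongr
              exact le_self_add
      · exact ⟨hQ0, hQ0e⟩
    · intro s hs
      simp only [Fin.sum_univ_two, Matrix.cons_val_zero, Matrix.cons_val_one, Measure.smul_apply,
        Measure.add_apply, smul_eq_mul, ENNReal.toReal_mul,
        ENNReal.toReal_add (measure_ne_top Q s) (measure_ne_top Q0 s), ENNReal.toReal_inv,
        ENNReal.toReal_ofNat]
      ring
  · rintro ⟨hQ, n, c, Qs, hQs, h⟩
    refine ⟨hQ, ?_⟩
    have hp := hQ.1
    have hps : ∀ i, IsProbabilityMeasure (Qs i) := fun i => (hQs i).1.1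
    have hle := ae_le_of_span P Q n c Qs hQ.2.1 hps (fun i => (hQs i).1.2.1) h
    set C : ℝ := ∑ i, |c i| + 1 with hC
    have hS : 0 ≤ ∑ i, |c i| := Finset.sum_nonneg fun i _ => abs_nonneg _
    have hC0 : 0 < C := by linarith
    obtain ⟨a, _, b, _, hg⟩ := hgrowth C C hC0 le_rfl
    have hT : ∫⁻ ω, ∑ i, (epos (Φ 1) +
        (ENNReal.ofReal a * epos (Φ (((Qs i).rnDeriv P ω).toReal)) +
        ENNReal.ofReal (b * (((Qs i).rnDeriv P ω).toReal + 1)))) ∂P < ⊤ := by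
      rw [lintegral_finsetSum]
      · rw [ENNReal.sum_lt_top]
        exact fun i _ => growth_finite hconv hbot P (Qs i) (hfin 1 one_pos) (hQs i).2 a b
      · intro i _
        exact measurable_const.add (((measurable_epos_rnDeriv hconv hbot P (Qs i)).const_mul _).add
          ((((Qs i).measurable_rnDeriv P).ennreal_toReal.add_const 1).const_mul b).ennreal_ofReal)
    have hmeas : MeasurableSet {ω | 1 ≤ (Q.rnDeriv P ω).toReal} :=
      measurableSet_le measurable_const (Q.measurable_rnDeriv P).ennreal_toReal
    unfold FiniteLossEntropy
    rw [← lintegral_indicator hmeas]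
    refine lt_of_le_of_lt (lintegral_mono_ae ?_) hT
    filter_upwards [hle] with ω hω
    by_cases h1 : 1 ≤ (Q.rnDeriv P ω).toReal
    · rw [indicator_of_mem (by exact h1)]
      obtain ⟨i, hi⟩ : ∃ i, (Q.rnDeriv P ω).toReal ≤ C * ((Qs i).rnDeriv P ω).toReal := by
        by_contra! hcon
        have h2 : ∀ i, |c i| * (C * ((Qs i).rnDeriv P ω).toReal)
            ≤ |c i| * (Q.rnDeriv P ω).toReal :=
          fun i => mul_le_mul_of_nonneg_left (hcon i).le (abs_nonneg _)
        have h3 := Finset.sum_le_sum (s := Finset.univ) fun i _ => h2 i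
        rw [← Finset.sum_mul] at h3
        have h4 : ∑ i, |c i| * (C * ((Qs i).rnDeriv P ω).toReal)
            = C * ∑ i, |c i| * ((Qs i).rnDeriv P ω).toReal := by
          rw [Finset.mul_sum]; exact Finset.sum_congr rfl fun i _ => by ring
        rw [h4] at h3
        have h5 := mul_le_mul_of_nonneg_left hω hC0.le
        nlinarith
      have hpos : 0 < ((Qs i).rnDeriv P ω).toReal :=
        pos_of_mul_pos_right (by linarith : 0 < C * ((Qs i).rnDeriv P ω).toReal) hC0.le
      refine (epos_quasi hconv hbot zero_le_one h1 hi).trans ?_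
      refine le_trans ?_ (Finset.single_le_sum (fun j _ => zero_le) (Finset.mem_univ i))
      exact max_le le_self_add ((hg _ hpos C ⟨le_rfl, le_rfl⟩).trans le_add_self)
    · rw [indicator_of_notMem (by exact h1)]
      exact zero_le

end
end

section
/- Let K be a wedge in L⁰ and let M be a nonempty face of M₁ = M₁(P;K). With E = ⋂_{Q∈M} L¹(Q), F = span{dQ/dP : Q ∈ M}, pairing ⟨z,w⟩ = E_P[zw], one has R(M)^◁ = c_E(K), the σ(E,F)-closure of the umbrella hull K − E_+. -/
open MeasureTheory Set ENNReal

noncomputable section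

variable {Ω : Type*} [MeasurableSpace Ω]

/-- The smallest wedge containing `S`. -/
def wedgeGenF {V : Type*} [AddCommMonoid V] [SMul ℝ V] (S : Set V) : Set V :=
  ⋂₀ {C : Set V | IsWedgeF C ∧ S ⊆ C}

/-- `R(Q) = dQ/dP`, the Radon–Nikodym derivative as an element of `L⁰(P)`. -/
def dens (P Q : Measure Ω) : Ω →ₘ[P] ℝ :=
  AEEqFun.mk (fun ω => (Q.rnDeriv P ω).toReal)
    (Measure.measurable_rnDeriv Q P).ennreal_toReal.aestronglyMeasurable

/-- The bilinear pairing `⟨z,w⟩ = E_P[zw]`. -/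
def pairP (P : Measure Ω) (z w : Ω →ₘ[P] ℝ) : ℝ :=
  ∫ ω, z ω * w ω ∂P

/-- the space `E = ⋂_{Q ∈ M} L¹(Q)` of `M`-integrable contingent claims. -/
def Espace (P : Measure Ω) (M : Set (Measure Ω)) : Set (Ω →ₘ[P] ℝ) :=
  {X | ∀ Q ∈ M, Integrable (X : Ω → ℝ) Q}

/-- the space `F`, the linear span of the densities `dQ/dP`, `Q ∈ M`. -/
def Fspace (P : Measure Ω) (M : Set (Measure Ω)) : Set (Ω →ₘ[P] ℝ) :=
  (Submodule.span ℝ (dens P '' M) : Set (Ω →ₘ[P] ℝ))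

/-- The umbrella hull `s_E(K) = K − E₊` inside `E`. -/
def umbrella (P : Measure Ω) (K D : Set (Ω →ₘ[P] ℝ)) : Set (Ω →ₘ[P] ℝ) :=
  {X | ∃ g ∈ K, ∃ p ∈ D, (0 ≤ᵐ[P] (p : Ω → ℝ)) ∧ X = g - p}

/-- The polar wedge, within `D`, of a set `A`, for the pairing `⟨z,w⟩ = E_P[zw]`. -/
def polarIn (P : Measure Ω) (D A : Set (Ω →ₘ[P] ℝ)) : Set (Ω →ₘ[P] ℝ) :=
  {w ∈ D | ∀ z ∈ A, pairP P z w ≤ 0}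

/-- The closure of `S` in the weak topology generated by the functionals
`v ↦ ⟨v,w⟩ = E_P[vw]`, `w ∈ D`. -/
def wcl (P : Measure Ω) (D S : Set (Ω →ₘ[P] ℝ)) : Set (Ω →ₘ[P] ℝ) :=
  {v | ∀ (n : ℕ) (w : Fin n → (Ω →ₘ[P] ℝ)), (∀ i, w i ∈ D) →
    ∀ ε : ℝ, 0 < ε → ∃ s ∈ S, ∀ i, |pairP P v (w i) - pairP P s (w i)| < ε}

/-- `c_E(K)`: the `σ(E,F)`-closure (within `E`) of the umbrella hull `s_E(K)`. -/
def cEK (P : Measure Ω) (K : Set (Ω →ₘ[P] ℝ)) (M : Set (Measure Ω)) : Set (Ω →ₘ[P] ℝ) :=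
  Espace P M ∩ wcl P (Fspace P M) (umbrella P K (Espace P M))

lemma dens_ae (P Q : Measure Ω) : (dens P Q : Ω → ℝ) =ᵐ[P] fun ω => (Q.rnDeriv P ω).toReal :=
  AEEqFun.coeFn_mk _ _

lemma dens_integrable_iff (P Q : Measure Ω) [IsProbabilityMeasure P] [IsFiniteMeasure Q]
    (h : Q ≪ P) (f : Ω → ℝ) :
    Integrable (fun ω => f ω * dens P Q ω) P ↔ Integrable f Q := by
  rw [← integrable_rnDeriv_smul_iff h]
  apply integrable_congr
  filter_upwards [dens_ae P Q] with ω hω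
  rw [hω, smul_eq_mul, mul_comm]

lemma dens_integral (P Q : Measure Ω) [IsProbabilityMeasure P] [IsFiniteMeasure Q]
    (h : Q ≪ P) (f : Ω → ℝ) :
    ∫ ω, f ω * dens P Q ω ∂P = ∫ ω, f ω ∂Q := by
  rw [← integral_rnDeriv_smul h]
  apply integral_congr_ae
  filter_upwards [dens_ae P Q] with ω hω
  rw [hω, smul_eq_mul, mul_comm]

lemma dens_inj (P Q Q' : Measure Ω) [IsProbabilityMeasure P] [IsFiniteMeasure Q]
    [IsFiniteMeasure Q'] (h : Q ≪ P) (h' : Q' ≪ P) (he : dens P Q = dens P Q') : Q = Q' := by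
  rw [← Measure.withDensity_rnDeriv_eq Q P h, ← Measure.withDensity_rnDeriv_eq Q' P h']
  apply withDensity_congr_ae
  have h1 := dens_ae P Q
  rw [he] at h1
  filter_upwards [h1, dens_ae P Q', Q.rnDeriv_lt_top P, Q'.rnDeriv_lt_top P] with ω a b c d
  rw [a] at b
  exact (ENNReal.toReal_eq_toReal_iff' c.ne d.ne).1 b

lemma dens_mix (P Q Q' : Measure Ω) [IsProbabilityMeasure P] [IsFiniteMeasure Q]
    [IsFiniteMeasure Q'] (x y : ℝ) (hx : 0 ≤ x) (hy : 0 ≤ y) :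
    dens P (ENNReal.ofReal x • Q + ENNReal.ofReal y • Q') = x • dens P Q + y • dens P Q' := by
  apply AEEqFun.ext
  have : IsFiniteMeasure (ENNReal.ofReal x • Q) := Measure.smul_finite _ ENNReal.ofReal_ne_top
  have : IsFiniteMeasure (ENNReal.ofReal y • Q') := Measure.smul_finite _ ENNReal.ofReal_ne_top
  filter_upwards [dens_ae P (ENNReal.ofReal x • Q + ENNReal.ofReal y • Q'), dens_ae P Q,
    dens_ae P Q', Measure.rnDeriv_add (ENNReal.ofReal x • Q) (ENNReal.ofReal y • Q') P,
    Measure.rnDeriv_smul_left_of_ne_top Q P (r := ENNReal.ofReal x) ENNReal.ofReal_ne_top,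
    Measure.rnDeriv_smul_left_of_ne_top Q' P (r := ENNReal.ofReal y) ENNReal.ofReal_ne_top,
    AEEqFun.coeFn_add (x • dens P Q) (y • dens P Q'),
    AEEqFun.coeFn_smul x (dens P Q), AEEqFun.coeFn_smul y (dens P Q'),
    Q.rnDeriv_lt_top P, Q'.rnDeriv_lt_top P] with ω h1 h2 h3 h4 h5 h6 h7 h8 h9 h10 h11
  rw [h1, h4, h7]
  simp only [Pi.add_apply]
  rw [h5, h6, h8, h9]
  simp only [Pi.smul_apply, h2, h3, smul_eq_mul]
  rw [ENNReal.toReal_add (ENNReal.mul_ne_top ENNReal.ofReal_ne_top h10.ne)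
    (ENNReal.mul_ne_top ENNReal.ofReal_ne_top h11.ne), ENNReal.toReal_mul, ENNReal.toReal_mul,
    ENNReal.toReal_ofReal hx, ENNReal.toReal_ofReal hy]

lemma dens_withDensity (P : Measure Ω) [IsProbabilityMeasure P] (w : Ω →ₘ[P] ℝ)
    (hw : 0 ≤ᵐ[P] (w : Ω → ℝ)) : dens P (P.withDensity fun ω => ENNReal.ofReal (w ω)) = w := by
  apply AEEqFun.ext
  filter_upwards [dens_ae P (P.withDensity fun ω => ENNReal.ofReal (w ω)), hw,
    Measure.rnDeriv_withDensity P w.measurable.ennreal_ofReal] with ω h1 h2 h3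
  rw [h1, h3, ENNReal.toReal_ofReal h2]

lemma Msep.mix_dens {P : Measure Ω} [IsProbabilityMeasure P] {K : Set (Ω →ₘ[P] ℝ)}
    {M : Set (Measure Ω)} (hsub : M ⊆ Msep P K) (hc : ConvexM M) {Q Q' : Measure Ω}
    (hQ : Q ∈ M) (hQ' : Q' ∈ M) {a b : ℝ} (ha : 0 ≤ a) (hb : 0 ≤ b) :
    ∃ R ∈ M, a • dens P Q + b • dens P Q' = (a + b) • dens P R := by
  rcases ha.eq_or_lt with rfl | ha
  · exact ⟨Q', hQ', by simp⟩
  rcases hb.eq_or_lt with rfl | hb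
  · exact ⟨Q, hQ, by simp⟩
  have hab : 0 < a + b := by positivity
  have := (hsub hQ).1
  have := (hsub hQ').1
  have hx1 : a / (a + b) < 1 := by rw [div_lt_one hab]; linarith
  refine ⟨_, hc Q hQ Q' hQ' (a / (a + b)) (by positivity) hx1, ?_⟩
  rw [dens_mix _ _ _ _ _ (by positivity) (by linarith), smul_add, smul_smul, smul_smul]
  congr 2 <;> field_simp
  ring

lemma span_rep {P : Measure Ω} [IsProbabilityMeasure P] {K : Set (Ω →ₘ[P] ℝ)}
    {M : Set (Measure Ω)} (hMne : M.Nonempty) (hsub : M ⊆ Msep P K) (hc : ConvexM M)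
    (w : Ω →ₘ[P] ℝ) (hw : w ∈ Fspace P M) :
    ∃ Q ∈ M, ∃ Q' ∈ M, ∃ a b : ℝ, 0 ≤ a ∧ 0 ≤ b ∧ w = a • dens P Q - b • dens P Q' := by
  obtain ⟨Q₀, hQ₀⟩ := hMne
  have hw' : w ∈ Submodule.span ℝ (dens P '' M) := hw
  induction hw' using Submodule.span_induction with
  | mem x hx =>
    obtain ⟨Q, hQ, rfl⟩ := hx
    exact ⟨Q, hQ, Q, hQ, 1, 0, zero_le_one, le_rfl, by simp⟩
  | zero => exact ⟨Q₀, hQ₀, Q₀, hQ₀, 0, 0, le_rfl, le_rfl, by simp⟩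
  | add x y hx hy ihx ihy =>
    obtain ⟨Q, hQ, Q', hQ', a, b, ha, hb, rfl⟩ := ihx hx
    obtain ⟨R, hR, R', hR', c, d, hc', hd, rfl⟩ := ihy hy
    obtain ⟨S, hS, h1⟩ := Msep.mix_dens hsub hc hQ hR ha hc'
    obtain ⟨S', hS', h2⟩ := Msep.mix_dens hsub hc hQ' hR' hb hd
    refine ⟨S, hS, S', hS', a + c, b + d, by positivity, by positivity, ?_⟩
    rw [← h1, ← h2]; abel
  | smul r x hx ih =>
    obtain ⟨Q, hQ, Q', hQ', a, b, ha, hb, rfl⟩ := ih hx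
    rcases le_total 0 r with hr | hr
    · exact ⟨Q, hQ, Q', hQ', r * a, r * b, by positivity, by positivity, by
        rw [smul_sub, smul_smul, smul_smul]⟩
    · refine ⟨Q', hQ', Q, hQ, -r * b, -r * a, mul_nonneg (by linarith) hb,
        mul_nonneg (by linarith) ha, ?_⟩
      rw [smul_sub, smul_smul, smul_smul, neg_mul, neg_mul, neg_smul, neg_smul]; abel

lemma EF_integrable {P : Measure Ω} [IsProbabilityMeasure P] {K : Set (Ω →ₘ[P] ℝ)}
    {M : Set (Measure Ω)} (hsub : M ⊆ Msep P K)
    {z w : Ω →ₘ[P] ℝ} (hz : z ∈ Espace P M) (hw : w ∈ Fspace P M) :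
    Integrable (fun ω => z ω * w ω) P := by
  have hw' : w ∈ Submodule.span ℝ (dens P '' M) := hw
  clear hw
  induction hw' using Submodule.span_induction with
  | mem x hx =>
    obtain ⟨Q, hQ, rfl⟩ := hx
    have := (hsub hQ).1
    exact (dens_integrable_iff P Q (hsub hQ).2.1 _).2 (hz Q hQ)
  | zero =>
    apply (integrable_zero Ω ℝ P).congr
    filter_upwards [AEEqFun.coeFn_zero (μ := P) (β := ℝ) (α := Ω)] with ω h
    simp [h]
  | add x y hx hy ihx ihy =>
    apply (ihx.add ihy).congr
    filter_upwards [AEEqFun.coeFn_add x y] with ω h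
    simp [h, mul_add]
  | smul r x hx ih =>
    apply (ih.const_mul r).congr
    filter_upwards [AEEqFun.coeFn_smul r x] with ω h
    simp only [h, Pi.smul_apply, smul_eq_mul]; ring

lemma pairP_comm (P : Measure Ω) (z w : Ω →ₘ[P] ℝ) : pairP P z w = pairP P w z := by
  simp only [pairP, mul_comm]

lemma pairP_add (P : Measure Ω) (z x y : Ω →ₘ[P] ℝ)
    (hx : Integrable (fun ω => z ω * x ω) P) (hy : Integrable (fun ω => z ω * y ω) P) :
    pairP P z (x + y) = pairP P z x + pairP P z y := by
  unfold pairP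
  rw [← integral_add hx hy]
  apply integral_congr_ae
  filter_upwards [AEEqFun.coeFn_add x y] with ω h
  simp [h, mul_add]

lemma pairP_smul (P : Measure Ω) (z x : Ω →ₘ[P] ℝ) (r : ℝ) :
    pairP P z (r • x) = r * pairP P z x := by
  unfold pairP
  rw [← integral_const_mul]
  apply integral_congr_ae
  filter_upwards [AEEqFun.coeFn_smul r x] with ω h
  simp only [h, Pi.smul_apply, smul_eq_mul]; ring

lemma pairP_sum {P : Measure Ω} [IsProbabilityMeasure P] {K : Set (Ω →ₘ[P] ℝ)}
    {M : Set (Measure Ω)} (hsub : M ⊆ Msep P K)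
    {z : Ω →ₘ[P] ℝ} (hz : z ∈ Espace P M) {ι : Type*} (t : Finset ι) (c : ι → ℝ)
    (w : ι → (Ω →ₘ[P] ℝ)) (hw : ∀ i, w i ∈ Fspace P M) :
    pairP P z (∑ i ∈ t, c i • w i) = ∑ i ∈ t, c i * pairP P z (w i) := by
  classical
  have hmem : ∀ i, c i • w i ∈ Fspace P M := fun i => Submodule.smul_mem _ _ (hw i)
  induction t using Finset.induction_on with
  | empty =>
    have := pairP_smul P z 0 0
    simpa using this
  | insert a t ha ih =>
    rw [Finset.sum_insert ha, Finset.sum_insert ha, pairP_add, ih, pairP_smul]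
    · exact EF_integrable hsub hz (hmem a)
    · exact EF_integrable hsub hz (Submodule.sum_mem _ fun i _ => hmem i)

lemma E_ae {P : Measure Ω} {K : Set (Ω →ₘ[P] ℝ)} {M : Set (Measure Ω)} (hsub : M ⊆ Msep P K)
    {z : Ω →ₘ[P] ℝ} {f : Ω → ℝ} (hf : ∀ Q ∈ M, Integrable f Q) (h : (z : Ω → ℝ) =ᵐ[P] f) :
    z ∈ Espace P M := fun Q hQ => (hf Q hQ).congr ((hsub hQ).2.1.ae_eq h.symm)

lemma E_add {P : Measure Ω} {K : Set (Ω →ₘ[P] ℝ)} {M : Set (Measure Ω)} (hsub : M ⊆ Msep P K)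
    {x y : Ω →ₘ[P] ℝ} (hx : x ∈ Espace P M) (hy : y ∈ Espace P M) : x + y ∈ Espace P M :=
  E_ae hsub (fun Q hQ => (hx Q hQ).add (hy Q hQ)) (AEEqFun.coeFn_add x y)

lemma E_smul {P : Measure Ω} {K : Set (Ω →ₘ[P] ℝ)} {M : Set (Measure Ω)} (hsub : M ⊆ Msep P K)
    {x : Ω →ₘ[P] ℝ} (r : ℝ) (hx : x ∈ Espace P M) : r • x ∈ Espace P M :=
  E_ae hsub (fun Q hQ => (hx Q hQ).smul r) (AEEqFun.coeFn_smul r x)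

lemma E_sub {P : Measure Ω} {K : Set (Ω →ₘ[P] ℝ)} {M : Set (Measure Ω)} (hsub : M ⊆ Msep P K)
    {x y : Ω →ₘ[P] ℝ} (hx : x ∈ Espace P M) (hy : y ∈ Espace P M) : x - y ∈ Espace P M :=
  E_ae hsub (fun Q hQ => (hx Q hQ).sub (hy Q hQ)) (AEEqFun.coeFn_sub x y)

lemma umbrella_sub {P : Measure Ω} {K : Set (Ω →ₘ[P] ℝ)} {M : Set (Measure Ω)}
    (hsub : M ⊆ Msep P K) : umbrella P K (Espace P M) ⊆ Espace P M := by
  rintro _ ⟨g, hg, p, hp, -, rfl⟩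
  exact E_sub hsub (fun Q hQ => ((hsub hQ).2.2 g hg).1) hp

lemma umbrella_add {P : Measure Ω} {K : Set (Ω →ₘ[P] ℝ)} {M : Set (Measure Ω)} (hK : IsWedgeF K)
    (hsub : M ⊆ Msep P K) {x y : Ω →ₘ[P] ℝ} (hx : x ∈ umbrella P K (Espace P M))
    (hy : y ∈ umbrella P K (Espace P M)) : x + y ∈ umbrella P K (Espace P M) := by
  obtain ⟨g, hg, p, hp, hp0, rfl⟩ := hx
  obtain ⟨g', hg', p', hp', hp0', rfl⟩ := hy
  refine ⟨g + g', hK.2.1 _ hg _ hg', p + p', E_add hsub hp hp', ?_, by abel⟩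
  filter_upwards [hp0, hp0', AEEqFun.coeFn_add p p'] with ω h1 h2 h3
  rw [h3]; exact add_nonneg h1 h2

lemma umbrella_smul {P : Measure Ω} {K : Set (Ω →ₘ[P] ℝ)} {M : Set (Measure Ω)} (hK : IsWedgeF K)
    (hsub : M ⊆ Msep P K) {x : Ω →ₘ[P] ℝ} (hx : x ∈ umbrella P K (Espace P M)) {r : ℝ}
    (hr : 0 ≤ r) : r • x ∈ umbrella P K (Espace P M) := by
  obtain ⟨g, hg, p, hp, hp0, rfl⟩ := hx
  refine ⟨r • g, hK.2.2 _ hr _ hg, r • p, E_smul hsub r hp, ?_, smul_sub _ _ _⟩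
  filter_upwards [hp0, AEEqFun.coeFn_smul r p] with ω h1 h3
  rw [h3]; exact mul_nonneg hr h1

lemma zero_mem_K {P : Measure Ω} {K : Set (Ω →ₘ[P] ℝ)} (hK : IsWedgeF K) : 0 ∈ K := by
  obtain ⟨g, hg⟩ := hK.1
  simpa using hK.2.2 0 le_rfl g hg

lemma K_sub_umbrella {P : Measure Ω} {K : Set (Ω →ₘ[P] ℝ)} {M : Set (Measure Ω)}
    (hsub : M ⊆ Msep P K) : K ⊆ umbrella P K (Espace P M) := by
  intro g hg
  refine ⟨g, hg, 0, E_ae hsub (fun Q _ => integrable_zero Ω ℝ Q) AEEqFun.coeFn_zero, ?_, by simp⟩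
  filter_upwards [AEEqFun.coeFn_zero (μ := P) (β := ℝ) (α := Ω)] with ω h
  simp [h]

/-- The finite-dimensional separation step. -/
lemma separate {P : Measure Ω} [IsProbabilityMeasure P] {K : Set (Ω →ₘ[P] ℝ)} (hK : IsWedgeF K)
    {M : Set (Measure Ω)} (hsub : M ⊆ Msep P K) {v : Ω →ₘ[P] ℝ} (hv : v ∈ Espace P M)
    (hn : v ∉ wcl P (Fspace P M) (umbrella P K (Espace P M))) :
    ∃ w ∈ Fspace P M, 0 < pairP P v w ∧ ∀ s ∈ umbrella P K (Espace P M), pairP P s w ≤ 0 := by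
  simp only [wcl, Set.mem_ofPred_eq, not_forall] at hn
  obtain ⟨n, w, hw, ε, hε, hn⟩ := hn
  push Not at hn
  set U := umbrella P K (Espace P M) with hU
  let T : (Ω →ₘ[P] ℝ) → (Fin n → ℝ) := fun z i => pairP P z (w i)
  have hTadd : ∀ x ∈ U, ∀ y ∈ U, T (x + y) = T x + T y := by
    intro x hx y hy
    funext i
    simp only [T, Pi.add_apply]
    rw [pairP_comm, pairP_add, pairP_comm, pairP_comm P (w i) y]
    · simpa only [mul_comm] using EF_integrable hsub (umbrella_sub hsub hx) (hw i)
    · simpa only [mul_comm] using EF_integrable hsub (umbrella_sub hsub hy) (hw i)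
  have hTsmul : ∀ (r : ℝ) x, T (r • x) = r • T x := by
    intro r x
    funext i
    simp only [T, Pi.smul_apply, smul_eq_mul]
    rw [pairP_comm, pairP_smul, pairP_comm]
  have hconv : Convex ℝ (T '' U) := by
    rintro _ ⟨x, hx, rfl⟩ _ ⟨y, hy, rfl⟩ a b ha hb -
    have h1 := umbrella_smul hK hsub hx ha
    have h2 := umbrella_smul hK hsub hy hb
    exact ⟨a • x + b • y, umbrella_add hK hsub h1 h2, by
      rw [hTadd _ h1 _ h2, hTsmul, hTsmul]⟩
  have hnot : T v ∉ closure (T '' U) := by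
    intro hcl
    rw [Metric.mem_closure_iff] at hcl
    obtain ⟨_, ⟨s, hs, rfl⟩, hd⟩ := hcl ε hε
    obtain ⟨i, hi⟩ := hn s hs
    rw [dist_pi_lt_iff hε] at hd
    exact absurd (hd i) (not_lt.2 (by rw [Real.dist_eq]; exact hi))
  obtain ⟨f, u, hfu, huv⟩ := geometric_hahn_banach_closed_point hconv.closure isClosed_closure hnot
  have hf : ∀ y, f y = ∑ i, f (Pi.single i 1) * y i := by
    intro y
    have := LinearMap.pi_apply_eq_sum_univ (f : (Fin n → ℝ) →ₗ[ℝ] ℝ) y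
    simp only [ContinuousLinearMap.coe_coe, smul_eq_mul] at this
    rw [this]
    refine Finset.sum_congr rfl fun i _ => ?_
    rw [mul_comm]
    congr 2
    funext j
    simp [Pi.single_apply, eq_comm]
  have hpair : ∀ z ∈ Espace P M, pairP P z (∑ i, f (Pi.single i 1) • w i) = f (T z) := by
    intro z hz
    rw [pairP_sum hsub hz _ _ _ hw, hf]
  have h0 : (0 : ℝ) < u := by
    have h0 : (0 : Ω →ₘ[P] ℝ) ∈ U := K_sub_umbrella hsub (zero_mem_K hK)
    have := hfu (T 0) (subset_closure ⟨0, h0, rfl⟩)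
    have h3 := hTsmul 0 0
    rw [zero_smul, zero_smul] at h3
    rwa [h3, map_zero] at this
  refine ⟨∑ i, f (Pi.single i 1) • w i,
    Submodule.sum_mem _ fun i _ => Submodule.smul_mem _ _ (hw i), ?_, ?_⟩
  · rw [hpair v hv]; linarith
  · intro s hs
    rw [hpair s (umbrella_sub hsub hs)]
    by_contra hpos
    push Not at hpos
    have hr : 0 ≤ u / f (T s) := by positivity
    have := hfu (T ((u / f (T s)) • s)) (subset_closure ⟨_, umbrella_smul hK hsub hs hr, rfl⟩)
    rw [hTsmul, map_smul, smul_eq_mul, div_mul_cancel₀ _ hpos.ne'] at this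
    exact lt_irrefl _ this

lemma nonneg_of_polar {P : Measure Ω} [IsProbabilityMeasure P] {K : Set (Ω →ₘ[P] ℝ)}
    (hK : IsWedgeF K)
    {M : Set (Measure Ω)} (hsub : M ⊆ Msep P K) {w : Ω →ₘ[P] ℝ} (hw : w ∈ Fspace P M)
    (hs : ∀ s ∈ umbrella P K (Espace P M), pairP P s w ≤ 0) : 0 ≤ᵐ[P] (w : Ω → ℝ) := by
  have hA : MeasurableSet {ω | w ω < 0} := measurableSet_lt w.measurable measurable_const
  let q : Ω → ℝ := Set.indicator {ω | w ω < 0} 1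
  have hqm : Measurable q := measurable_one.indicator hA
  let p : Ω →ₘ[P] ℝ := AEEqFun.mk q hqm.aestronglyMeasurable
  have hpq : (p : Ω → ℝ) =ᵐ[P] q := AEEqFun.coeFn_mk _ _
  have hpE : p ∈ Espace P M := E_ae hsub (fun Q hQ => by
    have := (hsub hQ).1
    exact (integrable_const (1 : ℝ)).indicator hA) hpq
  have hp0 : 0 ≤ᵐ[P] (p : Ω → ℝ) := by
    filter_upwards [hpq] with ω h
    rw [h]; exact Set.indicator_nonneg (fun _ _ => zero_le_one) _
  have h1 := hs (0 - p) ⟨0, zero_mem_K hK, p, hpE, hp0, rfl⟩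
  have h2 : pairP P (0 - p) w = ∫ ω, -(p ω * w ω) ∂P := by
    apply integral_congr_ae
    filter_upwards [AEEqFun.coeFn_neg p] with ω h
    rw [zero_sub, h]; simp
  rw [h2] at h1
  have hnn : 0 ≤ᵐ[P] fun ω => -(p ω * w ω) := by
    filter_upwards [hpq] with ω h
    rw [h]
    by_cases hc : w ω < 0
    · simp [q, hc, hc.le]
    · simp [q, hc]
  have h3 := (integral_eq_zero_iff_of_nonneg_ae hnn (EF_integrable hsub hpE hw).neg).1
    (le_antisymm h1 (integral_nonneg_of_ae hnn))
  filter_upwards [h3, hpq] with ω h4 h5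
  by_contra hc
  have hc : w ω < 0 := not_le.1 hc
  simp [h5, q, hc] at h4
  exact hc.ne h4

lemma polar_mem_cone {P : Measure Ω} [IsProbabilityMeasure P] {K : Set (Ω →ₘ[P] ℝ)}
    (hK : IsWedgeF K) {M : Set (Measure Ω)} (hMne : M.Nonempty) (hface : IsFaceOf M (Msep P K))
    {w : Ω →ₘ[P] ℝ} (hw : w ∈ Fspace P M)
    (hs : ∀ s ∈ umbrella P K (Espace P M), pairP P s w ≤ 0) :
    ∃ Q ∈ M, ∃ m : ℝ, 0 ≤ m ∧ w = m • dens P Q := by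
  obtain ⟨hsub, hc, hf⟩ := hface
  have h0 := nonneg_of_polar hK hsub hw hs
  obtain ⟨Q₁, hQ₁, Q₂, hQ₂, a, b, ha, hb, hrep⟩ := span_rep hMne hsub hc w hw
  have i1 := (hsub hQ₁).1
  have i2 := (hsub hQ₂).1
  have hone : ∀ Q ∈ M, Integrable (dens P Q : Ω → ℝ) P ∧ ∫ ω, dens P Q ω ∂P = 1 := by
    intro Q hQ
    have := (hsub hQ).1
    constructor
    · simpa using (dens_integrable_iff P Q (hsub hQ).2.1 (fun _ => 1)).2 (integrable_const _)
    · simpa using dens_integral P Q (hsub hQ).2.1 (fun _ => 1)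
  have hwae : (w : Ω → ℝ) =ᵐ[P] fun ω => a * dens P Q₁ ω - b * dens P Q₂ ω := by
    rw [hrep]
    filter_upwards [AEEqFun.coeFn_sub (a • dens P Q₁) (b • dens P Q₂),
      AEEqFun.coeFn_smul a (dens P Q₁), AEEqFun.coeFn_smul b (dens P Q₂)] with ω h1 h2 h3
    simp [h1, h2, h3]
  have hint' : Integrable (fun ω => a * dens P Q₁ ω - b * dens P Q₂ ω) P :=
    ((hone Q₁ hQ₁).1.const_mul a).sub ((hone Q₂ hQ₂).1.const_mul b)
  have hint : Integrable (w : Ω → ℝ) P := hint'.congr hwae.symm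
  have hmass : ∫ ω, w ω ∂P = a - b := by
    rw [integral_congr_ae hwae, integral_sub ((hone Q₁ hQ₁).1.const_mul a)
      ((hone Q₂ hQ₂).1.const_mul b), integral_const_mul, integral_const_mul,
      (hone Q₁ hQ₁).2, (hone Q₂ hQ₂).2, mul_one, mul_one]
  have hm0 : 0 ≤ a - b := hmass ▸ integral_nonneg_of_ae h0
  rcases hm0.eq_or_lt with hm | hm
  · refine ⟨Q₁, hQ₁, 0, le_rfl, ?_⟩
    rw [zero_smul]
    apply AEEqFun.ext
    exact ((integral_eq_zero_iff_of_nonneg_ae h0 hint).1 (hmass.trans hm.symm)).trans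
      AEEqFun.coeFn_zero.symm
  set m := a - b with hmdef
  let w' : Ω →ₘ[P] ℝ := m⁻¹ • w
  have hw'ae : (w' : Ω → ℝ) =ᵐ[P] fun ω => m⁻¹ * w ω := AEEqFun.coeFn_smul m⁻¹ w
  have hw'0 : 0 ≤ᵐ[P] (w' : Ω → ℝ) := by
    filter_upwards [hw'ae, h0] with ω h1 h2
    rw [h1]; exact mul_nonneg (by positivity) h2
  let Q : Measure Ω := P.withDensity fun ω => ENNReal.ofReal (w' ω)
  have hQP : Q ≪ P := withDensity_absolutelyContinuous _ _
  have hprob : IsProbabilityMeasure Q := by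
    constructor
    have hi : Integrable (w' : Ω → ℝ) P := (hint.const_mul m⁻¹).congr hw'ae.symm
    simp only [Q]
    rw [withDensity_apply _ MeasurableSet.univ, Measure.restrict_univ,
      ← ofReal_integral_eq_lintegral_ofReal hi hw'0, integral_congr_ae hw'ae,
      integral_const_mul, hmass, inv_mul_cancel₀ hm.ne', ENNReal.ofReal_one]
  have hdQ : dens P Q = m⁻¹ • w := dens_withDensity P w' hw'0
  have hwF : m⁻¹ • w ∈ Fspace P M := Submodule.smul_mem _ _ hw
  have hQsep : Q ∈ Msep P K := by
    refine ⟨hprob, hQP, fun X hX => ?_⟩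
    have hXU := K_sub_umbrella hsub hX
    constructor
    · rw [← dens_integrable_iff P Q hQP, hdQ]
      exact EF_integrable hsub (umbrella_sub hsub hXU) hwF
    · rw [← dens_integral P Q hQP, hdQ]
      change pairP P X (m⁻¹ • w) ≤ 0
      rw [pairP_smul]
      exact mul_nonpos_of_nonneg_of_nonpos (by positivity) (hs X hXU)
  have hwQ : w = m • dens P Q := by
    rw [hdQ, smul_smul, mul_inv_cancel₀ hm.ne', one_smul]
  refine ⟨Q, ?_, m, hm.le, hwQ⟩
  rcases hb.eq_or_lt with hb | hb
  · have : Q = Q₁ := by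
      apply dens_inj P Q Q₁ hQP (hsub hQ₁).2.1
      rw [hdQ, hrep, hmdef, ← hb]
      have : a ≠ 0 := by intro h; simp [hmdef, h, ← hb] at hm
      simp [smul_smul, this]
    rw [this]; exact hQ₁
  · have hapos : 0 < a := by linarith
    have hx0 : 0 < m / a := by positivity
    have hx1 : m / a < 1 := by rw [div_lt_one hapos]; linarith
    have hmixeq : ENNReal.ofReal (m / a) • Q + ENNReal.ofReal (1 - m / a) • Q₂ = Q₁ := by
      have : IsFiniteMeasure (ENNReal.ofReal (m / a) • Q) :=
        Measure.smul_finite _ ENNReal.ofReal_ne_top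
      have : IsFiniteMeasure (ENNReal.ofReal (1 - m / a) • Q₂) :=
        Measure.smul_finite _ ENNReal.ofReal_ne_top
      apply dens_inj P _ Q₁ _ (hsub hQ₁).2.1
      · rw [dens_mix _ _ _ _ _ hx0.le (by linarith), hdQ, hrep, smul_smul, smul_sub, smul_smul,
          smul_smul]
        have e1 : m / a * m⁻¹ * a = 1 := by field_simp
        have e2 : m / a * m⁻¹ * b = 1 - m / a := by
          have : b = a - m := by rw [hmdef]; ring
          rw [this]; field_simp
        rw [e1, e2, one_smul, sub_add_cancel]
      · exact Measure.AbsolutelyContinuous.add_left (hQP.smul_left _)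
          ((hsub hQ₂).2.1.smul_left _)
    exact (hf Q hQsep Q₂ (hsub hQ₂) (m / a) hx0 hx1 (hmixeq ▸ hQ₁)).1

/-- For a nonempty face `M` of `M₁(P;K)`, the polar wedge of `R(M)` equals
`c_E(K)`, the `σ(E,F)`-closure of the umbrella hull `K − E₊`. -/
theorem polar_face_eq_cEK (P : Measure Ω) [IsProbabilityMeasure P]
    (K : Set (Ω →ₘ[P] ℝ)) (hK : IsWedgeF K)
    (M : Set (Measure Ω)) (hMne : M.Nonempty) (hface : IsFaceOf M (Msep P K)) :
    polarIn P (Espace P M) (dens P '' M) = cEK P K M := by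
  have hsub := hface.1
  apply Set.Subset.antisymm
  · rintro v ⟨hvE, hv⟩
    refine ⟨hvE, ?_⟩
    by_contra hn
    obtain ⟨w, hw, hpos, hs⟩ := separate hK hsub hvE hn
    obtain ⟨Q, hQ, m, hm, rfl⟩ := polar_mem_cone hK hMne hface hw hs
    rw [pairP_smul, pairP_comm] at hpos
    have := mul_nonpos_of_nonneg_of_nonpos hm (hv _ ⟨Q, hQ, rfl⟩)
    linarith
  · rintro v ⟨hvE, hv⟩
    refine ⟨hvE, ?_⟩
    rintro _ ⟨Q, hQ, rfl⟩
    rw [pairP_comm]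
    apply _root_.le_of_forall_pos_le_add
    intro ε hε
    obtain ⟨s, ⟨g, hg, p, hp, hp0, rfl⟩, h⟩ := hv 1 (fun _ => dens P Q)
      (fun _ => Submodule.subset_span ⟨Q, hQ, rfl⟩) ε hε
    have h := (abs_lt.1 (h 0)).2
    have : IsProbabilityMeasure Q := (hsub hQ).1
    have hQP := (hsub hQ).2.1
    have hle : pairP P (g - p) (dens P Q) ≤ 0 := by
      unfold pairP
      rw [dens_integral P Q hQP, integral_congr_ae (hQP.ae_eq (AEEqFun.coeFn_sub g p))]
      simp only [Pi.sub_apply]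
      rw [integral_sub ((hsub hQ).2.2 g hg).1 (hp Q hQ)]
      have h1 := ((hsub hQ).2.2 g hg).2
      have h2 : 0 ≤ ∫ ω, p ω ∂Q := integral_nonneg_of_ae (hQP.ae_le hp0)
      linarith
    linarith

end
end

section
/- Let K be a wedge in L⁰ and ∅ ≠ M ⊆ M₁(P;K) with R(M)^◁ = c_E(K) (equivalently, the σ(F,E)-closure of cone(R(M)) equals F ∩ cone(R(M₁))). Then for every X ∈ E = ⋂_{Q∈M} L¹(Q), the set A_X(c_E(K)) = {x ∈ ℝ : X − x ∈ c_E(K)} is bounded below and inf A_X(c_E(K)) = sup_{Q∈M} E_Q[X]. In other words, the M-based super-replication price of X over the weakly closed umbrella c_E(K) equals the supremum of the expectations of X under measures in M. -/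
open MeasureTheory Set ENNReal

noncomputable section

variable {Ω : Type*} [MeasurableSpace Ω]

theorem pair_dens_eq (P : Measure Ω) [IsProbabilityMeasure P] (Q : Measure Ω)
    [IsProbabilityMeasure Q] (hQ : Q ≪ P) (z : Ω →ₘ[P] ℝ) :
    pairP P (dens P Q) z = ∫ ω, z ω ∂Q := by
  rw [← integral_rnDeriv_smul hQ]
  unfold pairP dens
  apply integral_congr_ae
  filter_upwards [AEEqFun.coeFn_mk (fun ω => (Q.rnDeriv P ω).toReal)
    (Measure.measurable_rnDeriv Q P).ennreal_toReal.aestronglyMeasurable] with ω h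
  rw [h, smul_eq_mul]

theorem sub_const_ae (P : Measure Ω) (X : Ω →ₘ[P] ℝ) (x : ℝ) :
    ((X - AEEqFun.const Ω x : Ω →ₘ[P] ℝ) : Ω → ℝ) =ᵐ[P] fun ω => X ω - x := by
  filter_upwards [AEEqFun.coeFn_sub X (AEEqFun.const Ω x),
    AEEqFun.coeFn_const (μ := P) Ω x] with ω h1 h2
  rw [h1, Pi.sub_apply, h2, Function.const_apply]

/-- General super-replication theorem: if `R(M)^◁ = c_E(K)`, then for every
`X ∈ E` the set `A_X(c_E(K)) = {x ∈ ℝ : X − x ∈ c_E(K)}` is bounded below and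
its infimum equals `sup_{Q ∈ M} E_Q[X]` (as extended reals). -/
theorem superreplication_price (P : Measure Ω) [IsProbabilityMeasure P]
    (K : Set (Ω →ₘ[P] ℝ)) (hK : IsWedgeF K)
    (M : Set (Measure Ω)) (hMne : M.Nonempty) (hM : M ⊆ Msep P K)
    (hdual : polarIn P (Espace P M) (dens P '' M) = cEK P K M)
    (X : Ω →ₘ[P] ℝ) (hX : X ∈ Espace P M) :
    BddBelow {x : ℝ | X - AEEqFun.const Ω x ∈ cEK P K M}
      ∧ sInf ((fun x : ℝ => (x : EReal)) '' {x : ℝ | X - AEEqFun.const Ω x ∈ cEK P K M})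
        = ⨆ Q ∈ M, ((∫ ω, X ω ∂Q : ℝ) : EReal) := by
  have key : ∀ x : ℝ, X - AEEqFun.const Ω x ∈ cEK P K M ↔ ∀ Q ∈ M, ∫ ω, X ω ∂Q ≤ x := by
    intro x
    have hint : ∀ Q ∈ M,
        Integrable ((X - AEEqFun.const Ω x : Ω →ₘ[P] ℝ) : Ω → ℝ) Q ∧
        pairP P (dens P Q) (X - AEEqFun.const Ω x) = ∫ ω, X ω ∂Q - x := by
      intro Q hQ
      obtain ⟨hp, hac, -⟩ := hM hQ
      have hae := hac.ae_eq (sub_const_ae P X x)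
      refine ⟨((hX Q hQ).sub (integrable_const x)).congr hae.symm, ?_⟩
      rw [pair_dens_eq P Q hac, integral_congr_ae hae,
        integral_sub (hX Q hQ) (integrable_const x)]
      simp
    rw [← hdual]
    constructor
    · rintro ⟨-, h⟩ Q hQ
      have := h _ (mem_image_of_mem _ hQ)
      rw [(hint Q hQ).2] at this
      linarith
    · intro h
      refine ⟨fun Q hQ => (hint Q hQ).1, ?_⟩
      rintro _ ⟨Q, hQ, rfl⟩
      rw [(hint Q hQ).2]
      linarith [h Q hQ]
  simp only [key]
  refine ⟨?_, le_antisymm ?_ ?_⟩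
  · obtain ⟨Q, hQ⟩ := hMne
    exact ⟨∫ ω, X ω ∂Q, fun x hx => hx Q hQ⟩
  · refine EReal.le_of_forall_lt_iff_le.mp ?_
    intro z hz
    refine sInf_le ⟨z, fun Q hQ => ?_, rfl⟩
    exact EReal.coe_le_coe_iff.mp ((le_iSup₂ (f := fun Q (_ : Q ∈ M) =>
      ((∫ ω, X ω ∂Q : ℝ) : EReal)) Q hQ).trans hz.le)
  · refine iSup₂_le fun Q hQ => le_sInf ?_
    rintro _ ⟨x, hx, rfl⟩
    exact EReal.coe_le_coe_iff.mpr (hx Q hQ)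

end
end
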